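/- Let Q denote the Minkowski quadratic form on ℝ⁴: Q(x) = −x₀² + x₁² + x₂² + x₃². For p ∈ ℝ⁴ and α > 0 define χ_p^α(x) = (α/π)² · exp(−α‖x − p‖²), where ‖·‖ is the Euclidean norm on ℝ⁴, and set f_α = χ_p^α − χ_q^α. Let p, q ∈ ℝ⁴ with Q(p − q) ≠ 0. Then, as α → ∞, ∫∫_{ℝ⁴×ℝ⁴} f_α(x) · f_α(y) · log|Q(x − y)| dx dy + 2·log(α·|Q(p − q)|) tends to (2/π⁴) · ∫∫_{ℝ⁴×ℝ⁴} exp(−2‖z‖² − ‖y‖²/2) · log|Q(y)| dy dz. -/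

import Mathlib

open Real MeasureTheory Filter

/-- The Minkowski quadratic form on `ℝ⁴`. -/
noncomputable def minkQ (x : EuclideanSpace ℝ (Fin 4)) : ℝ :=
  -(x 0) ^ 2 + (x 1) ^ 2 + (x 2) ^ 2 + (x 3) ^ 2

/-- The normalized Gaussian of width `1/√α` centered at `p`. -/
noncomputable def gaussChi (α : ℝ) (p x : EuclideanSpace ℝ (Fin 4)) : ℝ :=
  (α / π) ^ 2 * Real.exp (-α * ‖x - p‖ ^ 2)

lemma integrable_exp_neg_mul_norm_sq {b : ℝ} (hb : 0 < b) :
    Integrable (fun x : EuclideanSpace ℝ (Fin 4) => rexp (-b * ‖x‖ ^ 2)) := by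
  by_contra h
  have h1 := GaussianFourier.integral_rexp_neg_mul_sq_norm (V := EuclideanSpace ℝ (Fin 4)) hb
  rw [integral_undef h] at h1
  have : 0 < (π / b) ^ (Module.finrank ℝ (EuclideanSpace ℝ (Fin 4)) / 2 : ℝ) := by positivity
  linarith

lemma integral_exp_neg_mul_norm_sq {b : ℝ} (hb : 0 < b) :
    ∫ x : EuclideanSpace ℝ (Fin 4), rexp (-b * ‖x‖ ^ 2) = (π / b) ^ 2 := by
  rw [GaussianFourier.integral_rexp_neg_mul_sq_norm hb, finrank_euclideanSpace_fin,
    ← Real.rpow_natCast (π / b) 2]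
  norm_num

lemma integrable_exp_neg_mul_norm_sq_mul_norm {b : ℝ} (hb : 0 < b) :
    Integrable (fun x : EuclideanSpace ℝ (Fin 4) => rexp (-b * ‖x‖ ^ 2) * ‖x‖) := by
  refine ((integrable_exp_neg_mul_norm_sq (half_pos hb)).const_mul (1 + 2 / b)).mono'
    (by fun_prop) (.of_forall fun x => ?_)
  have h1 : ‖x‖ ≤ (1 + 2 / b) * rexp (b / 2 * ‖x‖ ^ 2) := by
    have h2 := Real.add_one_le_exp (b / 2 * ‖x‖ ^ 2)
    have h3 : ‖x‖ ≤ (1 + 2 / b) * (b / 2 * ‖x‖ ^ 2 + 1) := by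
      have : (1 + 2 / b) * (b / 2 * ‖x‖ ^ 2 + 1) = b / 2 * ‖x‖ ^ 2 + 1 + ‖x‖ ^ 2 + 2 / b := by
        field_simp
        ring
      have h4 : 0 < 2 / b := by positivity
      have h5 : 0 ≤ b / 2 * ‖x‖ ^ 2 := by positivity
      nlinarith [sq_nonneg (‖x‖ - 1)]
    exact h3.trans (by gcongr)
  rw [Real.norm_of_nonneg (by positivity)]
  calc rexp (-b * ‖x‖ ^ 2) * ‖x‖
      ≤ rexp (-b * ‖x‖ ^ 2) * ((1 + 2 / b) * rexp (b / 2 * ‖x‖ ^ 2)) := by gcongr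
    _ = (1 + 2 / b) * (rexp (-b * ‖x‖ ^ 2) * rexp (b / 2 * ‖x‖ ^ 2)) := by ring
    _ = (1 + 2 / b) * rexp (-(b / 2) * ‖x‖ ^ 2) := by
      rw [← Real.exp_add]
      congr 2
      ring

/-- Shearing the time coordinate by a function of the space coordinates preserves volume. -/
lemma measurePreserving_time_shear {g : (Fin 3 → ℝ) → ℝ} (hg : Measurable g) :
    MeasurePreserving (fun x : EuclideanSpace ℝ (Fin 4) =>
      ((fun i : Fin 3 => x i.succ : Fin 3 → ℝ), g (fun i => x i.succ) + x 0)) := by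
  have h1 : MeasurePreserving
      (fun p : (Fin 3 → ℝ) × ℝ => (p.1, g p.1 + p.2)) (volume.prod volume) (volume.prod volume) :=
    (MeasurePreserving.id _).skew_product (g := fun a t => g a + t)
      (by simp only [Function.uncurry_def]; fun_prop)
      (.of_forall fun a => map_add_left_eq_self _ _)
  have h2 := volume_preserving_piFinSuccAbove (fun _ : Fin 4 => ℝ) 0
  exact h1.comp (Measure.measurePreserving_swap.comp
    (h2.comp (PiLp.volume_preserving_ofLp (Fin 4))))

lemma norm_sq_eq_time_add_space (x : EuclideanSpace ℝ (Fin 4)) :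
    ‖x‖ ^ 2 = x 0 ^ 2 + ∑ i : Fin 3, x i.succ ^ 2 := by
  rw [EuclideanSpace.real_norm_sq_eq, Fin.sum_univ_succ]

lemma integrable_exp_neg_mul_norm_sq_mul_shear {b : ℝ} (hb : 0 < b) {k : ℝ → ℝ}
    (hkm : Measurable k) (hk : Integrable k) {g : (Fin 3 → ℝ) → ℝ} (hg : Measurable g) :
    Integrable (fun x : EuclideanSpace ℝ (Fin 4) =>
      rexp (-b * ‖x‖ ^ 2) * k (g (fun i => x i.succ) + x 0)) := by
  have hT := measurePreserving_time_shear hg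
  have h1 : Integrable (fun v : Fin 3 → ℝ => ∏ i, rexp (-b * v i ^ 2)) :=
    Integrable.fintype_prod (f := fun _ t => rexp (-b * t ^ 2))
      fun _ => integrable_exp_neg_mul_sq hb
  have h2 := hT.integrable_comp_of_integrable (h1.mul_prod hk)
  have h3 : Measurable fun x : EuclideanSpace ℝ (Fin 4) =>
      k (g (fun i => x i.succ) + x 0) := hkm.comp (measurable_snd.comp hT.measurable)
  refine h2.norm.mono' (by fun_prop) (.of_forall fun x => ?_)
  simp only [norm_mul, Function.comp_apply, ← Real.exp_sum, Real.norm_of_nonneg (Real.exp_nonneg _),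
    ← Finset.mul_sum]
  refine mul_le_mul_of_nonneg_right (Real.exp_le_exp.2 ?_) (norm_nonneg _)
  rw [norm_sq_eq_time_add_space]
  nlinarith [mul_nonneg hb.le (sq_nonneg (x 0))]

lemma ae_time_shear_ne_zero {g : (Fin 3 → ℝ) → ℝ} (hg : Measurable g) :
    ∀ᵐ x : EuclideanSpace ℝ (Fin 4), g (fun i => x i.succ) + x 0 ≠ 0 := by
  have h1 : ∀ᵐ p : (Fin 3 → ℝ) × ℝ, p.2 ≠ 0 :=
    Measure.quasiMeasurePreserving_snd.ae (p := fun t : ℝ => t ≠ 0)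
      (by simp [ae_iff])
  exact (measurePreserving_time_shear hg).quasiMeasurePreserving.ae h1

/-- The Euclidean length of a space vector. -/
noncomputable def spaceNorm (v : Fin 3 → ℝ) : ℝ := √(∑ i, v i ^ 2)

lemma measurable_spaceNorm : Measurable spaceNorm := by
  unfold spaceNorm
  fun_prop

lemma minkQ_eq_mul (x : EuclideanSpace ℝ (Fin 4)) :
    minkQ x = -((-spaceNorm (fun i => x i.succ) + x 0) *
      (spaceNorm (fun i => x i.succ) + x 0)) := by
  have h : spaceNorm (fun i => x i.succ) ^ 2 = ∑ i : Fin 3, x i.succ ^ 2 :=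
    Real.sq_sqrt (by positivity)
  have h2 : ∑ i : Fin 3, x i.succ ^ 2 = x 1 ^ 2 + x 2 ^ 2 + x 3 ^ 2 := by
    rw [Fin.sum_univ_three]
    rfl
  rw [minkQ]
  linear_combination -h - h2

lemma ae_minkQ_ne_zero : ∀ᵐ x : EuclideanSpace ℝ (Fin 4), minkQ x ≠ 0 := by
  filter_upwards [ae_time_shear_ne_zero measurable_spaceNorm,
    ae_time_shear_ne_zero measurable_spaceNorm.neg] with x h1 h2
  rw [minkQ_eq_mul]
  exact neg_ne_zero.2 (mul_ne_zero h2 h1)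

lemma continuous_minkQ : Continuous minkQ := by
  unfold minkQ
  fun_prop

lemma minkQ_smul (t : ℝ) (x : EuclideanSpace ℝ (Fin 4)) : minkQ (t • x) = t ^ 2 * minkQ x := by
  simp only [minkQ, PiLp.smul_apply, smul_eq_mul]
  ring

lemma minkQ_neg (x : EuclideanSpace ℝ (Fin 4)) : minkQ (-x) = minkQ x := by
  simp [minkQ]

lemma abs_log_mul_le (a b : ℝ) : |log (a * b)| ≤ |log a| + |log b| := by
  rcases eq_or_ne a 0 with rfl | ha
  · simp
  rcases eq_or_ne b 0 with rfl | hb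
  · simp
  rw [Real.log_mul ha hb]
  exact abs_add_le _ _

lemma abs_log_le_indicator_add_abs (t : ℝ) :
    |log t| ≤ (Set.uIoc (-1) 1).indicator (fun s => |log s|) t + |t| := by
  by_cases h : t ∈ Set.uIoc (-1 : ℝ) 1
  · rw [Set.indicator_of_mem h]
    exact le_add_of_nonneg_right (abs_nonneg t)
  · rw [Set.indicator_of_notMem h, zero_add, ← Real.log_abs]
    have h1 : 1 ≤ |t| := by
      by_contra! h2
      rw [abs_lt] at h2
      exact h (by rw [Set.uIoc_of_le (by norm_num)]; exact ⟨h2.1, h2.2.le⟩)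
    rw [abs_of_nonneg (Real.log_nonneg h1)]
    exact (Real.log_le_sub_one_of_pos (by linarith)).trans (by linarith)

lemma integrable_exp_neg_mul_norm_sq_mul_log_minkQ {b : ℝ} (hb : 0 < b) :
    Integrable (fun x : EuclideanSpace ℝ (Fin 4) =>
      rexp (-b * ‖x‖ ^ 2) * log |minkQ x|) := by
  set k : ℝ → ℝ := (Set.uIoc (-1) 1).indicator fun s => |log s|
  have hkm : Measurable k := by
    refine Measurable.indicator ?_ measurableSet_uIoc
    fun_prop
  have hk : Integrable k :=
    (integrable_indicator_iff measurableSet_uIoc).2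
      (intervalIntegrable_iff.1 intervalIntegral.intervalIntegrable_log').norm
  have h1 := integrable_exp_neg_mul_norm_sq_mul_shear hb hkm hk measurable_spaceNorm
  have h2 := integrable_exp_neg_mul_norm_sq_mul_shear hb hkm hk measurable_spaceNorm.neg
  have hm := continuous_minkQ.measurable
  refine ((h1.add h2).add ((integrable_exp_neg_mul_norm_sq_mul_norm hb).const_mul 4)).mono'
    (by fun_prop) (.of_forall fun x => ?_)
  simp only [Pi.add_apply, Pi.neg_apply]
  set r := spaceNorm (fun i => x i.succ) with hr
  have hrx : |r| ≤ ‖x‖ := by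
    refine abs_le_of_sq_le_sq ?_ (norm_nonneg x)
    rw [hr, spaceNorm, Real.sq_sqrt (by positivity), norm_sq_eq_time_add_space]
    linarith [sq_nonneg (x 0)]
  have hx0 : |x 0| ≤ ‖x‖ := PiLp.norm_apply_le x 0
  have hlog : |log (|minkQ x|)| ≤ k (r + x 0) + k (-r + x 0) + 4 * ‖x‖ := by
    rw [Real.log_abs, minkQ_eq_mul, Real.log_neg_eq_log]
    have e1 := abs_log_mul_le (-r + x 0) (r + x 0)
    have e2 := abs_log_le_indicator_add_abs (-r + x 0)
    have e3 := abs_log_le_indicator_add_abs (r + x 0)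
    have e4 := abs_add_le (-r) (x 0)
    have e5 := abs_add_le r (x 0)
    rw [abs_neg] at e4
    linarith
  rw [norm_mul, Real.norm_of_nonneg (Real.exp_nonneg _), Real.norm_eq_abs]
  calc _ ≤ rexp (-b * ‖x‖ ^ 2) * (k (r + x 0) + k (-r + x 0) + 4 * ‖x‖) := by gcongr
    _ = _ := by ring

lemma integrable_exp_neg_mul_norm_sub_sq_mul_log_minkQ {b : ℝ} (hb : 0 < b)
    (c : EuclideanSpace ℝ (Fin 4)) :
    Integrable (fun x : EuclideanSpace ℝ (Fin 4) =>
      rexp (-b * ‖x - c‖ ^ 2) * log |minkQ x|) := by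
  have hm := continuous_minkQ.measurable
  refine ((integrable_exp_neg_mul_norm_sq_mul_log_minkQ (half_pos hb)).norm.const_mul
    (rexp (b * ‖c‖ ^ 2))).mono' (by fun_prop) (.of_forall fun x => ?_)
  rw [norm_mul, norm_mul, Real.norm_of_nonneg (Real.exp_nonneg _),
    Real.norm_of_nonneg (Real.exp_nonneg _), ← mul_assoc, ← Real.exp_add]
  gcongr
  have h1 : ‖x‖ ≤ ‖x - c‖ + ‖c‖ := by simpa using norm_add_le (x - c) c
  have h2 : ‖x‖ ^ 2 ≤ 2 * ‖x - c‖ ^ 2 + 2 * ‖c‖ ^ 2 := by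
    nlinarith [sq_nonneg (‖x - c‖ - ‖c‖), norm_nonneg x]
  nlinarith

lemma gaussChi_mul_gaussChi_sub (α : ℝ) (a b x w : EuclideanSpace ℝ (Fin 4)) :
    gaussChi α a x * gaussChi α b (x - w) =
      (α / π) ^ 4 * (rexp (-(α / 2) * ‖w - (a - b)‖ ^ 2) *
        rexp (-(2 * α) * ‖x - (1 / 2 : ℝ) • (a + b + w)‖ ^ 2)) := by
  have h1 := parallelogram_law_with_norm ℝ (x - a) (x - w - b)
  have h2 : x - a + (x - w - b) = (2 : ℝ) • (x - (1 / 2 : ℝ) • (a + b + w)) := by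
    module
  have h3 : x - a - (x - w - b) = w - (a - b) := by abel
  rw [h2, h3, norm_smul, Real.norm_of_nonneg zero_le_two] at h1
  have h4 : rexp (-α * ‖x - a‖ ^ 2) * rexp (-α * ‖x - w - b‖ ^ 2) =
      rexp (-(α / 2) * ‖w - (a - b)‖ ^ 2) *
        rexp (-(2 * α) * ‖x - (1 / 2 : ℝ) • (a + b + w)‖ ^ 2) := by
    rw [← Real.exp_add, ← Real.exp_add]
    congr 1
    linear_combination α / 2 * h1
  rw [gaussChi, gaussChi, ← h4]
  ring

lemma integrable_gaussChi_mul_gaussChi_sub_mul_log {α : ℝ} (hα : 0 < α)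
    (a b : EuclideanSpace ℝ (Fin 4)) :
    Integrable (fun p : EuclideanSpace ℝ (Fin 4) × EuclideanSpace ℝ (Fin 4) =>
      gaussChi α a p.1 * gaussChi α b (p.1 - p.2) * log |minkQ p.2|)
      (volume.prod volume) := by
  have hT : MeasurePreserving
      (fun p : EuclideanSpace ℝ (Fin 4) × EuclideanSpace ℝ (Fin 4) =>
        (p.1, p.2 - (1 / 2 : ℝ) • (a + b + p.1))) (volume.prod volume) (volume.prod volume) :=
    (MeasurePreserving.id _).skew_product (g := fun w x => x - (1 / 2 : ℝ) • (a + b + w))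
      (by simp only [Function.uncurry_def]; fun_prop)
      (.of_forall fun w => (measurePreserving_sub_right volume _).map_eq)
  have h1 := hT.integrable_comp_of_integrable
    ((integrable_exp_neg_mul_norm_sub_sq_mul_log_minkQ (half_pos hα) (a - b)).mul_prod
      (integrable_exp_neg_mul_norm_sq (b := 2 * α) (by positivity)))
  refine (h1.swap.const_mul ((α / π) ^ 4)).congr (.of_forall fun p => ?_)
  simp only [gaussChi_mul_gaussChi_sub, Function.comp_apply, Prod.fst_swap, Prod.snd_swap]
  ring

lemma integrable_gaussChi_mul_gaussChi_mul_log {α : ℝ} (hα : 0 < α)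
    (a b : EuclideanSpace ℝ (Fin 4)) :
    Integrable (fun p : EuclideanSpace ℝ (Fin 4) × EuclideanSpace ℝ (Fin 4) =>
      gaussChi α a p.1 * gaussChi α b p.2 * log |minkQ (p.1 - p.2)|)
      (volume.prod volume) := by
  have hT : MeasurePreserving
      (fun p : EuclideanSpace ℝ (Fin 4) × EuclideanSpace ℝ (Fin 4) =>
        (p.1, p.1 - p.2)) (volume.prod volume) (volume.prod volume) :=
    (MeasurePreserving.id _).skew_product (g := fun x y => x - y)
      (by simp only [Function.uncurry_def]; fun_prop)
      (.of_forall fun x => (Measure.measurePreserving_sub_left volume x).map_eq)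
  simpa only [Function.comp_def, sub_sub_cancel] using!
    hT.integrable_comp_of_integrable (integrable_gaussChi_mul_gaussChi_sub_mul_log hα a b)

/-- The mean of `log |Q|` under the normalized Gaussian of width `√(2/α)` centered at `c`. -/
noncomputable def gaussLogMean (α : ℝ) (c : EuclideanSpace ℝ (Fin 4)) : ℝ :=
  (α / (2 * π)) ^ 2 * ∫ w : EuclideanSpace ℝ (Fin 4),
    rexp (-(α / 2) * ‖w - c‖ ^ 2) * log |minkQ w|

lemma integral_integral_gaussChi_mul_gaussChi_mul_log {α : ℝ} (hα : 0 < α)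
    (a b : EuclideanSpace ℝ (Fin 4)) :
    ∫ x, ∫ y, gaussChi α a x * gaussChi α b y * log |minkQ (x - y)| =
      gaussLogMean α (a - b) := by
  have h1 (x : EuclideanSpace ℝ (Fin 4)) :
      ∫ y, gaussChi α a x * gaussChi α b y * log |minkQ (x - y)| =
        ∫ w, gaussChi α a x * gaussChi α b (x - w) * log |minkQ w| := by
    rw [← integral_sub_left_eq_self _ volume x]
    simp only [sub_sub_cancel]
  have h2 (w : EuclideanSpace ℝ (Fin 4)) :
      ∫ x, gaussChi α a x * gaussChi α b (x - w) * log |minkQ w| =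
        (α / (2 * π)) ^ 2 * (rexp (-(α / 2) * ‖w - (a - b)‖ ^ 2) * log |minkQ w|) := by
    simp only [gaussChi_mul_gaussChi_sub]
    rw [integral_mul_const, integral_const_mul, integral_const_mul,
      integral_sub_right_eq_self (fun x => rexp (-(2 * α) * ‖x‖ ^ 2)),
      integral_exp_neg_mul_norm_sq (by positivity)]
    field_simp
  simp only [h1]
  rw [integral_integral_swap (integrable_gaussChi_mul_gaussChi_sub_mul_log hα a b)]
  simp only [h2, integral_const_mul, gaussLogMean]

lemma gaussLogMean_zero {α : ℝ} (hα : 0 < α) :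
    gaussLogMean α 0 = gaussLogMean 1 0 - log α := by
  have hs : 0 < √α := Real.sqrt_pos.2 hα
  have h1 : gaussLogMean 1 0 = (1 / (2 * π)) ^ 2 * ∫ w : EuclideanSpace ℝ (Fin 4),
      (√α ^ 4 * (rexp (-(α / 2) * ‖w‖ ^ 2) * log |minkQ w|) +
        √α ^ 4 * log α * rexp (-(α / 2) * ‖w‖ ^ 2)) := by
    rw [gaussLogMean]
    congr 1
    have h2 := Measure.integral_comp_smul (volume : Measure (EuclideanSpace ℝ (Fin 4)))
      (fun w => rexp (-(1 / 2) * ‖w - 0‖ ^ 2) * log |minkQ w|) √α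
    rw [finrank_euclideanSpace_fin, abs_of_pos (by positivity), smul_eq_mul,
      eq_inv_mul_iff_mul_eq₀ (by positivity), ← integral_const_mul] at h2
    rw [← h2]
    refine integral_congr_ae ?_
    filter_upwards [ae_minkQ_ne_zero] with w hw
    rw [minkQ_smul, sub_zero, norm_smul, Real.norm_of_nonneg hs.le, mul_pow, Real.sq_sqrt hα.le,
      abs_mul, abs_of_pos hα, Real.log_mul hα.ne' (abs_ne_zero.2 hw)]
    ring_nf
  have h3 : √α ^ 4 = α ^ 2 := by
    rw [show 4 = 2 * 2 from rfl, pow_mul, Real.sq_sqrt hα.le]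
  have h4 := integrable_exp_neg_mul_norm_sq_mul_log_minkQ (half_pos hα)
  have h5 := integrable_exp_neg_mul_norm_sq (half_pos hα)
  rw [h1, integral_add (h4.const_mul _) (h5.const_mul _), integral_const_mul, integral_const_mul,
    integral_exp_neg_mul_norm_sq (half_pos hα), h3, gaussLogMean]
  simp only [sub_zero]
  field_simp
  ring

lemma tendsto_gaussLogMean {c : EuclideanSpace ℝ (Fin 4)} (hc : minkQ c ≠ 0) :
    Tendsto (fun α => gaussLogMean α c) atTop (nhds (log |minkQ c|)) := by
  have key := tendsto_integral_comp_smul_smul_of_integrable'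
    (μ := (volume : Measure (EuclideanSpace ℝ (Fin 4))))
    (φ := fun w => (1 / (2 * π)) ^ 2 * rexp (-(1 / 2) * ‖w‖ ^ 2))
    (g := fun w => rexp (-(1 / 2) * ‖w - c‖ ^ 2) * log |minkQ w|) (x₀ := c)
    (fun _ => by positivity)
    (by
      rw [integral_const_mul, integral_exp_neg_mul_norm_sq (by norm_num)]
      field_simp)
    (by
      have A : Tendsto (fun w : EuclideanSpace ℝ (Fin 4) => ‖w‖ ^ 2)
          (Bornology.cobounded _) atTop :=
        (tendsto_pow_atTop two_ne_zero).comp tendsto_norm_cobounded_atTop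
      have B := ((tendsto_rpow_mul_exp_neg_mul_atTop_nhds_zero 2 (1 / 2)
        (by norm_num)).comp A).const_mul ((1 / (2 * π)) ^ 2)
      rw [mul_zero] at B
      refine B.congr fun w => ?_
      rw [finrank_euclideanSpace_fin, Function.comp_apply, Real.rpow_ofNat]
      ring)
    (integrable_exp_neg_mul_norm_sub_sq_mul_log_minkQ (by norm_num) c)
    (by
      have h := continuous_minkQ.continuousAt (x := c)
      exact (by fun_prop : ContinuousAt _ c).mul (h.abs.log (abs_ne_zero.2 hc)))
  have hsqrt : Tendsto (fun α : ℝ => √(α - 1)) atTop atTop :=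
    Real.tendsto_sqrt_atTop.comp (tendsto_atTop_add_const_right _ _ tendsto_id)
  have hratio : Tendsto (fun α : ℝ => (1 + (α - 1)⁻¹) ^ 2) atTop (nhds 1) := by
    have h : Tendsto (fun α : ℝ => (α - 1)⁻¹) atTop (nhds 0) :=
      tendsto_inv_atTop_zero.comp (tendsto_atTop_add_const_right _ _ tendsto_id)
    simpa using (h.const_add 1).pow 2
  have h1 := hratio.mul (key.comp hsqrt)
  rw [sub_self, norm_zero, zero_pow two_ne_zero, mul_zero, Real.exp_zero, one_mul, one_mul] at h1
  refine h1.congr' ?_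
  filter_upwards [eventually_gt_atTop 1] with α hα
  have hα1 : 0 < α - 1 := sub_pos.2 hα
  have h4 : √(α - 1) ^ 4 = (α - 1) ^ 2 := by
    rw [show 4 = 2 * 2 from rfl, pow_mul, Real.sq_sqrt hα1.le]
  have h5 : (α / (2 * π)) ^ 2 =
      (1 + (α - 1)⁻¹) ^ 2 * ((α - 1) ^ 2 * (1 / (2 * π)) ^ 2) := by
    field_simp
    ring
  rw [gaussLogMean, h5, mul_assoc, Function.comp_apply,
    finrank_euclideanSpace_fin, h4]
  congr 1
  rw [← integral_const_mul]
  congr 1 with w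
  rw [norm_smul, Real.norm_of_nonneg (Real.sqrt_nonneg _), mul_pow, Real.sq_sqrt hα1.le,
    norm_sub_rev c w, smul_eq_mul, show -(α / 2) * ‖w - c‖ ^ 2 =
      -(1 / 2) * ((α - 1) * ‖w - c‖ ^ 2) + -(1 / 2) * ‖w - c‖ ^ 2 by ring, Real.exp_add]
  ring

/-- Minimal-variance Gaussian limit of the logarithmic kernel: with
`f_α = χ_p^α − χ_q^α`, the quadratic form of `log|Q(x−y)|` plus `2 log(α |Q(p−q)|)`
converges to an explicit Gaussian integral as `α → ∞`. -/
theorem gaussian_log_kernel_limit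
    (p q : EuclideanSpace ℝ (Fin 4)) (hpq : minkQ (p - q) ≠ 0) :
    Tendsto (fun α : ℝ =>
        (∫ x : EuclideanSpace ℝ (Fin 4), ∫ y : EuclideanSpace ℝ (Fin 4),
            (gaussChi α p x - gaussChi α q x) * (gaussChi α p y - gaussChi α q y) *
              Real.log |minkQ (x - y)|) +
          2 * Real.log (α * |minkQ (p - q)|))
      atTop
      (nhds ((2 / π ^ 4) * ∫ z : EuclideanSpace ℝ (Fin 4), ∫ y : EuclideanSpace ℝ (Fin 4),
          Real.exp (-2 * ‖z‖ ^ 2 - ‖y‖ ^ 2 / 2) * Real.log |minkQ y|)) := by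
  have hqp : minkQ (q - p) = minkQ (p - q) := by rw [← neg_sub, minkQ_neg]
  have hlim : (2 / π ^ 4) * ∫ z : EuclideanSpace ℝ (Fin 4), ∫ y : EuclideanSpace ℝ (Fin 4),
      Real.exp (-2 * ‖z‖ ^ 2 - ‖y‖ ^ 2 / 2) * Real.log |minkQ y| = 2 * gaussLogMean 1 0 := by
    have h1 (z y : EuclideanSpace ℝ (Fin 4)) : Real.exp (-2 * ‖z‖ ^ 2 - ‖y‖ ^ 2 / 2) =
        rexp (-2 * ‖z‖ ^ 2) * rexp (-(1 / 2) * ‖y - 0‖ ^ 2) := by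
      rw [← Real.exp_add, sub_zero]
      ring_nf
    simp only [h1, mul_assoc, integral_const_mul]
    rw [integral_mul_const, integral_exp_neg_mul_norm_sq two_pos, gaussLogMean]
    field_simp
  rw [hlim]
  have hmain : Tendsto (fun α : ℝ => 2 * gaussLogMean 1 0 - gaussLogMean α (p - q) -
      gaussLogMean α (q - p) + 2 * log |minkQ (p - q)|) atTop (nhds (2 * gaussLogMean 1 0)) := by
    have h := (((tendsto_gaussLogMean hpq).const_sub (2 * gaussLogMean 1 0)).sub
      (tendsto_gaussLogMean (hqp ▸ hpq))).add_const (2 * log |minkQ (p - q)|)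
    rw [hqp] at h
    convert! h using 2
    ring
  refine hmain.congr' ?_
  filter_upwards [eventually_gt_atTop 0] with α hα
  have hI (a b) := integrable_gaussChi_mul_gaussChi_mul_log hα a b
  have hL (a b) := (integral_prod _ (hI a b)).trans
    (integral_integral_gaussChi_mul_gaussChi_mul_log hα a b)
  have hsplit : ∫ x : EuclideanSpace ℝ (Fin 4), ∫ y : EuclideanSpace ℝ (Fin 4),
      (gaussChi α p x - gaussChi α q x) * (gaussChi α p y - gaussChi α q y) *
        Real.log |minkQ (x - y)| =
      gaussLogMean α (p - p) - gaussLogMean α (p - q) -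
        (gaussLogMean α (q - p) - gaussLogMean α (q - q)) := by
    simp only [← hL]
    rw [← integral_sub' (hI p p) (hI p q), ← integral_sub' (hI q p) (hI q q),
      ← integral_sub' ((hI p p).sub (hI p q)) ((hI q p).sub (hI q q)), integral_integral]
    · congr 1 with z
      simp only [Pi.sub_apply]
      ring
    · refine (((hI p p).sub (hI p q)).sub ((hI q p).sub (hI q q))).congr (.of_forall fun z => ?_)
      simp only [Pi.sub_apply, Function.uncurry_def]
      ring
  rw [hsplit, sub_self, sub_self, gaussLogMean_zero hα,
    Real.log_mul hα.ne' (abs_ne_zero.2 hpq)]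
  ring
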